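/- arXiv:2106.09376 — 9 statements merged into one kernel-verified Lean document; each statement's English description precedes it below -/
import Mathlib

section
/- Let k ∈ ℕ, and for 1 ≤ i ≤ k let d_i ∈ ℕ, Δ_i ≥ 0, σ_i > 0, and let m_i, m_i' ∈ ℝ^{d_i} satisfy ‖m_i − m_i'‖₂ ≤ Δ_i. Set μ = Σ_{i=1}^k Δ_i²/(2σ_i²) and assume μ > 0. Let P = ⊗_{i=1}^k N(m_i, σ_i² I_{d_i}) and Q = ⊗_{i=1}^k N(m_i', σ_i² I_{d_i}) be the corresponding product Gaussian measures on ∏_{i=1}^k ℝ^{d_i}. Then for every ε ≥ 0 and every measurable set S ⊆ ∏_{i=1}^k ℝ^{d_i}, P(S) ≤ e^ε Q(S) + δ(ε), where δ(ε) = ½( erfc((ε − μ)/(2√μ)) − e^ε · erfc((ε + μ)/(2√μ)) ). In other words, the composition of k Gaussian mechanisms with queries of ℓ₂-sensitivity at most Δ_i and noise variances σ_i² is (ε, δ(ε))-ADP. -/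
open MeasureTheory ProbabilityTheory

/-- The complementary error function `erfc x = (2/√π) ∫_x^∞ e^{−t²} dt`. -/
noncomputable def erfc (x : ℝ) : ℝ := (2 / Real.sqrt Real.pi) * ∫ t in Set.Ioi x, Real.exp (-t ^ 2)

/-- The Gaussian measure `N(m, σ²I_n)` on `ℝ^n` (with variance `v = σ²`), as the product of
one-dimensional Gaussian measures. -/
noncomputable def gaussPi (n : ℕ) (m : Fin n → ℝ) (v : NNReal) : Measure (Fin n → ℝ) :=
  Measure.pi fun j => gaussianReal (m j) v

instance (n : ℕ) (m : Fin n → ℝ) (v : NNReal) : IsProbabilityMeasure (gaussPi n m v) := by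
  unfold gaussPi; infer_instance

open scoped NNReal ENNReal

structure GP {X : Type*} [MeasurableSpace X] (P Q : Measure X) (L : X → ℝ) (v : ℝ≥0) : Prop where
  meas : Measurable L
  dens : P = Q.withDensity fun x => ENNReal.ofReal (Real.exp (L x))
  law : Q.map L = gaussianReal (-((v : ℝ) / 2)) v

lemma gauss_dens (a b : ℝ) (v : ℝ≥0) (hv : v ≠ 0) :
    gaussianReal a v = (gaussianReal b v).withDensity fun x =>
      ENNReal.ofReal (Real.exp ((a - b) / v * x + (- (a ^ 2 - b ^ 2) / (2 * v)))) := by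
  have hv' : (v : ℝ) ≠ 0 := by exact_mod_cast hv
  rw [gaussianReal_of_var_ne_zero _ hv, gaussianReal_of_var_ne_zero _ hv,
    ← withDensity_mul _ (measurable_gaussianPDF _ _) (by fun_prop)]
  congr 1
  ext x
  simp only [Pi.mul_apply, gaussianPDF]
  rw [← ENNReal.ofReal_mul (gaussianPDFReal_nonneg _ _ _)]
  congr 1
  rw [gaussianPDFReal, gaussianPDFReal, mul_assoc (Real.sqrt _)⁻¹, ← Real.exp_add]
  congr 2
  field_simp
  ring

lemma gp_real (a b : ℝ) (v : ℝ≥0) (hv : v ≠ 0) (w : ℝ≥0) (hw : (w : ℝ) = (a - b) ^ 2 / v) :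
    GP (gaussianReal a v) (gaussianReal b v)
      (fun x => (a - b) / v * x + (- (a ^ 2 - b ^ 2) / (2 * v))) w := by
  have hv' : (v : ℝ) ≠ 0 := by exact_mod_cast hv
  refine ⟨by fun_prop, gauss_dens a b v hv, ?_⟩
  have h1 := gaussianReal_map_const_mul (μ := b) (v := v) ((a - b) / v)
  have : (fun x : ℝ => (a - b) / v * x + (- (a ^ 2 - b ^ 2) / (2 * v)))
    = (fun x => x + (- (a ^ 2 - b ^ 2) / (2 * v))) ∘ (fun x => (a - b) / v * x) := rfl
  rw [this, ← Measure.map_map (by fun_prop) (by fun_prop), h1, gaussianReal_map_add_const]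
  congr 1
  · rw [hw]; field_simp; ring
  · ext
    rw [NNReal.coe_mul, hw]
    simp only [NNReal.coe_mk]
    field_simp

lemma gp_pi {ι : Type*} [Fintype ι] {X : ι → Type*} [∀ i, MeasurableSpace (X i)]
    (P Q : ∀ i, Measure (X i)) [∀ i, IsProbabilityMeasure (P i)]
    [∀ i, IsProbabilityMeasure (Q i)] (L : ∀ i, X i → ℝ)
    (v : ι → ℝ≥0) (h : ∀ i, GP (P i) (Q i) (L i) (v i)) :
    GP (Measure.pi P) (Measure.pi Q) (fun x => ∑ i, L i (x i)) (∑ i, v i) := by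
  have hm : ∀ i, Measurable (L i) := fun i => (h i).meas
  have hm2 : Measurable (fun x : ∀ i, X i => ∑ i, L i (x i)) := by fun_prop
  refine ⟨hm2, ?_, ?_⟩
  · symm
    refine (Measure.pi_eq fun s hs => ?_).symm
    rw [withDensity_apply _ (MeasurableSet.univ_pi hs), ← lintegral_indicator (MeasurableSet.univ_pi hs)]
    have hmg : ∀ i, Measurable ((s i).indicator fun x => ENNReal.ofReal (Real.exp (L i x))) :=
      fun i => Measurable.indicator (by fun_prop) (hs i)
    have hind : iIndepFun (fun i (x : ∀ i, X i) =>
        (s i).indicator (fun x => ENNReal.ofReal (Real.exp (L i x))) (x i)) (Measure.pi Q) :=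
      iIndepFun_pi (μ := Q) (fun i => (hmg i).aemeasurable)
    have e : ∀ x : ∀ i, X i, (Set.univ.pi s).indicator
        (fun x => ENNReal.ofReal (Real.exp (∑ i, L i (x i)))) x
        = ∏ i, (s i).indicator (fun x => ENNReal.ofReal (Real.exp (L i x))) (x i) := by
      intro x
      by_cases hx : x ∈ Set.univ.pi s
      · rw [Set.indicator_of_mem hx, Real.exp_sum,
          ENNReal.ofReal_prod_of_nonneg (fun i _ => (Real.exp_pos _).le)]
        refine Finset.prod_congr rfl fun i _ => ?_
        rw [Set.indicator_of_mem (hx i trivial)]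
      · rw [Set.indicator_of_notMem hx]
        simp only [Set.mem_univ_pi, not_forall] at hx
        obtain ⟨i, hi⟩ := hx
        symm
        exact Finset.prod_eq_zero (Finset.mem_univ i) (Set.indicator_of_notMem hi _)
    simp_rw [e]
    rw [lintegral_prod_eq_prod_lintegral_of_indepFun Finset.univ _ hind
      (fun i => (hmg i).comp (measurable_pi_apply i))]
    refine Finset.prod_congr rfl fun i _ => ?_
    rw [(measurePreserving_eval Q i).lintegral_comp (hmg i), lintegral_indicator (hs i),
      ← withDensity_apply _ (hs i), ← (h i).dens]
  · haveI : IsFiniteMeasure ((Measure.pi Q).map (fun x => ∑ i, L i (x i))) :=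
      Measure.isFiniteMeasure_map _ _
    refine Measure.ext_of_charFun ?_
    ext t
    rw [charFun_gaussianReal, charFun_apply_real, integral_map hm2.aemeasurable (by fun_prop)]
    have e : ∀ x : ∀ i, X i, Complex.exp (t * (∑ i, L i (x i) : ℝ) * Complex.I)
        = ∏ i, Complex.exp (t * (L i (x i)) * Complex.I) := by
      intro x
      rw [← Complex.exp_sum]
      push_cast
      rw [Finset.mul_sum, Finset.sum_mul]
    simp_rw [e]
    rw [integral_fintype_prod_eq_prod (fun i (x : X i) => Complex.exp (t * (L i x) * Complex.I))]
    have e2 : ∀ i, ∫ x, Complex.exp (t * (L i x) * Complex.I) ∂(Q i)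
        = Complex.exp (t * ((-((v i : ℝ) / 2) : ℝ)) * Complex.I - v i * t ^ 2 / 2) := by
      intro i
      have := charFun_gaussianReal (μ := -((v i : ℝ) / 2)) (v := v i) t
      rw [← this, ← (h i).law, charFun_apply_real, integral_map (hm i).aemeasurable (by fun_prop)]
    simp_rw [e2]
    rw [← Complex.exp_sum]
    congr 1
    push_cast
    simp only [Finset.sum_sub_distrib, Finset.sum_div, Finset.mul_sum, Finset.sum_mul,
      Finset.sum_neg_distrib, mul_neg, neg_mul]

lemma gp_prod {X Y : Type*} [MeasurableSpace X] [MeasurableSpace Y]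
    (P Q : Measure X) (P' Q' : Measure Y) [IsProbabilityMeasure Q] [IsProbabilityMeasure Q']
    (L : X → ℝ) (L' : Y → ℝ) (v v' : ℝ≥0) (h : GP P Q L v) (h' : GP P' Q' L' v') :
    GP (P.prod P') (Q.prod Q') (fun z => L z.1 + L' z.2) (v + v') := by
  have hm := h.meas
  have hm' := h'.meas
  refine ⟨by fun_prop, ?_, ?_⟩
  · rw [h.dens, h'.dens, prod_withDensity (by fun_prop) (by fun_prop)]
    congr 1
    ext z
    rw [Real.exp_add, ENNReal.ofReal_mul (Real.exp_pos _).le]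
  · have hi : IndepFun (fun z : X × Y => L z.1) (fun z => L' z.2) (Q.prod Q') :=
      indepFun_prod hm hm'
    have := gaussianReal_add_gaussianReal_of_indepFun hi
      (m₁ := -((v : ℝ) / 2)) (v₁ := v) (m₂ := -((v' : ℝ) / 2)) (v₂ := v') (by
        rw [← h.law, ← (measurePreserving_fst (μ := Q) (ν := Q')).map_eq,
          Measure.map_map hm measurable_fst]; simp [Function.comp_def]) (by
        rw [← h'.law, ← (measurePreserving_snd (μ := Q) (ν := Q')).map_eq,
          Measure.map_map hm' measurable_snd]; simp [Function.comp_def])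
    have e : (-((v : ℝ) / 2)) + (-((v' : ℝ) / 2)) = -(((v + v' : ℝ≥0) : ℝ) / 2) := by
      push_cast; ring
    rw [e] at this
    exact this

lemma gauss_tail (a c μ : ℝ) (hμ : 0 < μ) :
    (gaussianReal a (Real.toNNReal (2 * μ))) (Set.Ioi c)
      = ENNReal.ofReal (1 / 2 * erfc ((c - a) / (2 * Real.sqrt μ))) := by
  have hs : 0 < Real.sqrt μ := Real.sqrt_pos.2 hμ
  have hmap : gaussianReal a (Real.toNNReal (2 * μ))
      = (gaussianReal 0 (Real.toNNReal (1 / 2))).map (fun x => 2 * Real.sqrt μ * x + a) := by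
    have : (fun x : ℝ => 2 * Real.sqrt μ * x + a)
      = (fun x => x + a) ∘ (fun x => 2 * Real.sqrt μ * x) := rfl
    rw [this, ← Measure.map_map (by fun_prop) (by fun_prop), gaussianReal_map_const_mul,
      gaussianReal_map_add_const]
    congr 1
    · simp
    · ext
      rw [NNReal.coe_mul, Real.coe_toNNReal _ (by positivity), Real.coe_toNNReal _ (by positivity)]
      simp only [NNReal.coe_mk]
      rw [mul_pow, Real.sq_sqrt hμ.le]; ring
  rw [hmap, Measure.map_apply (by fun_prop) measurableSet_Ioi]
  have hpre : (fun x => 2 * Real.sqrt μ * x + a) ⁻¹' (Set.Ioi c)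
      = Set.Ioi ((c - a) / (2 * Real.sqrt μ)) := by
    ext x
    simp only [Set.mem_preimage, Set.mem_Ioi]
    rw [div_lt_iff₀ (by positivity)]
    constructor <;> intro h <;> linarith
  rw [hpre, gaussianReal_apply_eq_integral _ (by simp)]
  congr 1
  rw [erfc, ← mul_assoc, ← integral_const_mul]
  congr 1
  ext x
  rw [gaussianPDFReal, Real.coe_toNNReal _ (by positivity)]
  congr 1
  · rw [show 2 * Real.pi * (1 / 2) = Real.pi by ring]; ring
  · congr 1; ring

lemma gp_main {X : Type*} [MeasurableSpace X] (P Q : Measure X) [IsProbabilityMeasure P]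
    [IsProbabilityMeasure Q] (L : X → ℝ) (μ : ℝ) (hμ : 0 < μ)
    (h : GP P Q L (Real.toNNReal (2 * μ))) (ε : ℝ) (S : Set X) (hS : MeasurableSet S) :
    P S ≤ ENNReal.ofReal (Real.exp ε) * Q S
      + ENNReal.ofReal ((1 / 2) * (erfc ((ε - μ) / (2 * Real.sqrt μ))
          - Real.exp ε * erfc ((ε + μ) / (2 * Real.sqrt μ)))) := by
  have hm := h.meas
  have hc : ((Real.toNNReal (2 * μ) : ℝ≥0) : ℝ) = 2 * μ := Real.coe_toNNReal _ (by positivity)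
  have hlaw : Q.map L = gaussianReal (-μ) (Real.toNNReal (2 * μ)) := by
    rw [h.law, hc]; congr 1; ring
  have hlawP : P.map L = gaussianReal μ (Real.toNNReal (2 * μ)) := by
    rw [gauss_dens μ (-μ) _ (by simpa using hμ), ← hlaw]
    ext s hs
    rw [Measure.map_apply hm hs, h.dens, withDensity_apply _ (hm hs), withDensity_apply _ hs,
      setLIntegral_map hs (by fun_prop) hm]
    congr 1
    ext x
    rw [hc]
    congr 2
    field_simp
    ring
  set A := L ⁻¹' (Set.Ioi ε) with hA
  have hAm : MeasurableSet A := hm measurableSet_Ioi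
  have hPA : P A = ENNReal.ofReal (1 / 2 * erfc ((ε - μ) / (2 * Real.sqrt μ))) := by
    rw [hA, ← Measure.map_apply hm measurableSet_Ioi, hlawP, gauss_tail _ _ _ hμ]
  have hQA : Q A = ENNReal.ofReal (1 / 2 * erfc ((ε + μ) / (2 * Real.sqrt μ))) := by
    rw [hA, ← Measure.map_apply hm measurableSet_Ioi, hlaw, gauss_tail _ _ _ hμ, sub_neg_eq_add]
  have herfc : ∀ x, 0 ≤ erfc x := fun x => by
    unfold erfc
    exact mul_nonneg (by positivity) (integral_nonneg fun t => (Real.exp_pos _).le)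
  have hPA' : P.real A = 1 / 2 * erfc ((ε - μ) / (2 * Real.sqrt μ)) := by
    rw [Measure.real, hPA, ENNReal.toReal_ofReal (by have := herfc ((ε - μ) / (2 * Real.sqrt μ)); positivity)]
  have hQA' : Q.real A = 1 / 2 * erfc ((ε + μ) / (2 * Real.sqrt μ)) := by
    rw [Measure.real, hQA, ENNReal.toReal_ofReal (by have := herfc ((ε + μ) / (2 * Real.sqrt μ)); positivity)]
  have h1 : P.real (S \ A) ≤ Real.exp ε * Q.real (S \ A) := by
    have : P (S \ A) ≤ ENNReal.ofReal (Real.exp ε) * Q (S \ A) := by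
      rw [h.dens, withDensity_apply _ (hS.diff hAm), ← setLIntegral_const]
      refine setLIntegral_mono measurable_const fun x hx => ?_
      have : ¬ ε < L x := hx.2
      exact ENNReal.ofReal_le_ofReal (Real.exp_le_exp.2 (not_lt.1 this))
    have := ENNReal.toReal_mono (by finiteness) this
    rwa [ENNReal.toReal_mul, ENNReal.toReal_ofReal (Real.exp_pos _).le] at this
  have h2 : Real.exp ε * Q.real (A \ S) ≤ P.real (A \ S) := by
    have : ENNReal.ofReal (Real.exp ε) * Q (A \ S) ≤ P (A \ S) := by
      rw [h.dens, withDensity_apply _ (hAm.diff hS), ← setLIntegral_const]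
      refine setLIntegral_mono (by fun_prop) fun x hx => ?_
      have : ε < L x := hx.1
      exact ENNReal.ofReal_le_ofReal (Real.exp_le_exp.2 this.le)
    have := ENNReal.toReal_mono (by finiteness) this
    rwa [ENNReal.toReal_mul, ENNReal.toReal_ofReal (Real.exp_pos _).le] at this
  have a1 := measureReal_inter_add_diff (μ := P) (s := S) hAm
  have a2 := measureReal_inter_add_diff (μ := Q) (s := S) hAm
  have a3 := measureReal_inter_add_diff (μ := P) (s := A) hS
  have a4 := measureReal_inter_add_diff (μ := Q) (s := A) hS
  rw [Set.inter_comm] at a3 a4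
  have key : P.real S ≤ Real.exp ε * Q.real S + (P.real A - Real.exp ε * Q.real A) := by
    rw [← a1, ← a2, ← a3, ← a4]; linarith
  have hk : (1 / 2) * (erfc ((ε - μ) / (2 * Real.sqrt μ))
          - Real.exp ε * erfc ((ε + μ) / (2 * Real.sqrt μ))) = P.real A - Real.exp ε * Q.real A := by
    rw [hPA', hQA']; ring
  rw [hk, ← ofReal_measureReal (μ := P) (s := S), ← ofReal_measureReal (μ := Q) (s := S),
    ← ENNReal.ofReal_mul (Real.exp_pos _).le]
  exact (ENNReal.ofReal_le_ofReal key).trans ENNReal.ofReal_add_le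

/-- Tight ADP bound for the composition of `k` Gaussian mechanisms
(Theorem `gauss_composition_theorem`). -/
theorem composition_of_gaussian_mechanisms_is_ADP
    (k : ℕ) (d : Fin k → ℕ) (Δ σ : Fin k → ℝ)
    (hΔ : ∀ i, 0 ≤ Δ i) (hσ : ∀ i, 0 < σ i)
    (m m' : ∀ i, Fin (d i) → ℝ)
    (hsens : ∀ i, Real.sqrt (∑ j, (m i j - m' i j) ^ 2) ≤ Δ i)
    (μ : ℝ) (hμ : μ = ∑ i, Δ i ^ 2 / (2 * σ i ^ 2)) (hμpos : 0 < μ)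
    (P Q : Measure (∀ i, Fin (d i) → ℝ))
    (hP : P = Measure.pi fun i => gaussPi (d i) (m i) (Real.toNNReal (σ i ^ 2)))
    (hQ : Q = Measure.pi fun i => gaussPi (d i) (m' i) (Real.toNNReal (σ i ^ 2)))
    (ε : ℝ) (hε : 0 ≤ ε) (S : Set (∀ i, Fin (d i) → ℝ)) (hS : MeasurableSet S) :
    P S ≤ ENNReal.ofReal (Real.exp ε) * Q S
      + ENNReal.ofReal ((1 / 2) * (erfc ((ε - μ) / (2 * Real.sqrt μ))
          - Real.exp ε * erfc ((ε + μ) / (2 * Real.sqrt μ)))) := by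
  have hv : ∀ i, Real.toNNReal (σ i ^ 2) ≠ 0 := fun i => by
    have := hσ i
    simpa using this.ne'
  have hvc : ∀ i, ((Real.toNNReal (σ i ^ 2) : ℝ≥0) : ℝ) = σ i ^ 2 := fun i =>
    Real.coe_toNNReal _ (sq_nonneg _)
  let w : ∀ i, Fin (d i) → ℝ≥0 := fun i j =>
    ⟨(m i j - m' i j) ^ 2 / (Real.toNNReal (σ i ^ 2) : ℝ≥0), by positivity⟩
  have hgp := gp_pi (fun i => gaussPi (d i) (m i) (Real.toNNReal (σ i ^ 2)))
    (fun i => gaussPi (d i) (m' i) (Real.toNNReal (σ i ^ 2))) _ _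
    (fun i => gp_pi (fun j => gaussianReal (m i j) (Real.toNNReal (σ i ^ 2)))
      (fun j => gaussianReal (m' i j) (Real.toNNReal (σ i ^ 2))) _ _
      (fun j => gp_real (m i j) (m' i j) _ (hv i) (w i j) rfl))
  rw [← hP, ← hQ] at hgp
  have hle : ((∑ i, ∑ j, w i j : ℝ≥0) : ℝ) ≤ 2 * μ := by
    push_cast
    rw [hμ, Finset.mul_sum]
    refine Finset.sum_le_sum fun i _ => ?_
    have h1 : ∑ j, (m i j - m' i j) ^ 2 ≤ Δ i ^ 2 :=
      (Real.sqrt_le_left (hΔ i)).1 (hsens i)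
    have h2 : ∑ j, (w i j : ℝ) = (∑ j, (m i j - m' i j) ^ 2) / σ i ^ 2 := by
      rw [Finset.sum_div]
      refine Finset.sum_congr rfl fun j _ => ?_
      rw [← hvc i]; rfl
    rw [h2]
    have := hσ i
    calc _ ≤ Δ i ^ 2 / σ i ^ 2 := by gcongr
      _ = _ := by field_simp
  set s : ℝ≥0 := ∑ i, ∑ j, w i j with hs
  set r : ℝ≥0 := ⟨2 * μ - s, by linarith⟩ with hr
  have hrc : (r : ℝ) = 2 * μ - s := rfl
  have hg2 := gp_real (Real.sqrt r) 0 1 one_ne_zero r (by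
    simp)
  haveI : IsProbabilityMeasure P := by rw [hP]; infer_instance
  haveI : IsProbabilityMeasure Q := by rw [hQ]; infer_instance
  have hg3 := gp_prod _ _ _ _ _ _ _ _ hgp hg2
  have hsum : s + r = Real.toNNReal (2 * μ) := by
    ext
    rw [Real.coe_toNNReal _ (by positivity), NNReal.coe_add, hrc]; ring
  rw [hsum] at hg3
  have := gp_main _ _ _ μ hμpos hg3 ε (S ×ˢ Set.univ) (hS.prod MeasurableSet.univ)
  simpa [Measure.prod_prod] using this
end

section
/- Let Δ ∈ ℝ, σ > 0, and set μ = Δ²/(2σ²). Let p and q denote the Lebesgue densities of the one-dimensional Gaussian measures N(0, σ²) and N(Δ, σ²) respectively. Then the pushforward of N(0, σ²) under the map t ↦ ln(p(t)/q(t)) is the Gaussian measure N(μ, 2μ). That is, the privacy loss distribution of the Gaussian mechanism with sensitivity Δ and noise variance σ² is N(μ, 2μ). -/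
open MeasureTheory ProbabilityTheory

/-- The privacy loss distribution of the Gaussian mechanism with sensitivity `Δ` and noise
variance `σ²` is `N(μ, 2μ)` with `μ = Δ²/(2σ²)`: the pushforward of `N(0, σ²)` under the
log-likelihood-ratio map `t ↦ ln (p t / q t)`, where `p`, `q` are the densities of
`N(0, σ²)` and `N(Δ, σ²)`, is `N(μ, 2μ)`. -/
theorem privacy_loss_distribution_of_gaussian_mechanism
    (Δ σ : ℝ) (hσ : 0 < σ) (μ : ℝ) (hμ : μ = Δ ^ 2 / (2 * σ ^ 2)) :
    (gaussianReal 0 (Real.toNNReal (σ ^ 2))).map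
        (fun t => Real.log (gaussianPDFReal 0 (Real.toNNReal (σ ^ 2)) t /
          gaussianPDFReal Δ (Real.toNNReal (σ ^ 2)) t))
      = gaussianReal μ (Real.toNNReal (2 * μ)) := by
  have hs : (0:ℝ) ≤ σ ^ 2 := sq_nonneg σ
  have hne : σ ≠ 0 := hσ.ne'
  have hf : (fun t => Real.log (gaussianPDFReal 0 (Real.toNNReal (σ ^ 2)) t /
          gaussianPDFReal Δ (Real.toNNReal (σ ^ 2)) t))
      = (fun x => x + μ) ∘ (fun t => (-Δ / σ ^ 2) * t) := by
    funext t
    have hc : (√(2 * Real.pi * σ ^ 2))⁻¹ ≠ 0 := by positivity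
    simp only [gaussianPDFReal, Real.coe_toNNReal _ hs, Function.comp]
    rw [mul_div_mul_left _ _ hc, ← Real.exp_sub, Real.log_exp, hμ]
    field_simp
    ring
  rw [hf, ← Measure.map_map (by fun_prop) (by fun_prop), gaussianReal_map_const_mul,
    gaussianReal_map_add_const]
  have hμ0 : 0 ≤ 2 * μ := by rw [hμ]; positivity
  congr 1
  · simp
  · apply NNReal.coe_injective
    rw [NNReal.coe_mul, Real.coe_toNNReal _ hs, Real.coe_toNNReal _ hμ0, hμ]
    change (-Δ / σ ^ 2) ^ 2 * σ ^ 2 = _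
    field_simp
end

section
/- Let d ∈ ℕ, σ > 0, Δ > 0, and let x, y ∈ ℝ^d with ‖x − y‖₂ ≤ Δ. Set μ = Δ²/(2σ²). Then for every ε ≥ 0 and every measurable S ⊆ ℝ^d, N(x, σ²I_d)(S) ≤ e^ε · N(y, σ²I_d)(S) + δ(ε), where δ(ε) = ½( erfc((ε − μ)/(2√μ)) − e^ε · erfc((ε + μ)/(2√μ)) ). -/
open MeasureTheory ProbabilityTheory

lemma gauss_tail_std (t : ℝ) :
    gaussianReal 0 (1/2) (Set.Ioi t) = ENNReal.ofReal ((1/2) * erfc t) := by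
  rw [gaussianReal_apply_eq_integral _ (by norm_num), erfc]
  congr 1
  rw [← mul_assoc, ← integral_const_mul]
  congr 1
  funext u
  rw [gaussianPDFReal]
  have : (2 : ℝ) * Real.pi * ((1/2 : NNReal) : ℝ) = Real.pi := by push_cast; ring
  rw [this]
  congr 1
  · field_simp
  · congr 1
    push_cast; ring

lemma gauss_tail_s2 (m s t : ℝ) (hs : 0 < s) (v : NNReal) (hv : (v : ℝ) = s ^ 2) :
    gaussianReal m v (Set.Ioi t) = ENNReal.ofReal ((1/2) * erfc ((t - m) / (s * Real.sqrt 2))) := by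
  have h2 : 0 < s * Real.sqrt 2 := by positivity
  have h : gaussianReal m v = ((gaussianReal 0 (1/2)).map (fun z => s * Real.sqrt 2 * z)).map
      (fun z => z + m) := by
    rw [gaussianReal_map_const_mul, gaussianReal_map_add_const]
    congr 1
    · simp
    · apply NNReal.coe_injective
      rw [hv]
      push_cast
      rw [mul_pow, Real.sq_sqrt (by norm_num)]; ring
  rw [h, Measure.map_apply (by fun_prop) measurableSet_Ioi,
    Measure.map_apply (by fun_prop) (measurableSet_Ioi.preimage (by fun_prop)), ← gauss_tail_std]
  congr 1
  ext z
  simp only [Set.mem_preimage, Set.mem_Ioi]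
  rw [div_lt_iff₀ h2]
  constructor <;> intro h <;> linarith

lemma gauss_tilt (a b : ℝ) (v : NNReal) (hv : v ≠ 0) :
    gaussianReal a v = (gaussianReal b v).withDensity
      (fun z => ENNReal.ofReal (Real.exp (((a - b) * z - (a ^ 2 - b ^ 2) / 2) / v))) := by
  have hv' : (v : ℝ) ≠ 0 := by exact_mod_cast hv
  rw [gaussianReal_of_var_ne_zero _ hv, gaussianReal_of_var_ne_zero _ hv,
    ← withDensity_mul _ (by fun_prop) (by fun_prop)]
  congr 1
  funext z
  rw [Pi.mul_apply, gaussianPDF, gaussianPDF, ← ENNReal.ofReal_mul (gaussianPDFReal_nonneg _ _ _),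
    gaussianPDFReal, gaussianPDFReal, mul_assoc (Real.sqrt _)⁻¹, ← Real.exp_add]
  congr 3
  field_simp
  ring

lemma gaussPi_tilt (d : ℕ) (x y : Fin d → ℝ) (v : NNReal) (hv : v ≠ 0) :
    gaussPi d x v = (gaussPi d y v).withDensity
      (fun z => ENNReal.ofReal (Real.exp ((∑ i, (x i - y i) * z i
        - (∑ i, (x i ^ 2 - y i ^ 2)) / 2) / v))) := by
  unfold gaussPi
  apply Measure.pi_eq
  intro s hs
  rw [withDensity_apply _ (MeasurableSet.univ_pi hs), ← lintegral_indicator (MeasurableSet.univ_pi hs)]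
  set g : Fin d → ℝ → ENNReal := fun i => (s i).indicator
    (fun z => ENNReal.ofReal (Real.exp (((x i - y i) * z - (x i ^ 2 - y i ^ 2) / 2) / v))) with hg
  have hgm : ∀ i, Measurable (g i) := fun i => Measurable.indicator (by fun_prop) (hs i)
  have e : ∀ z : Fin d → ℝ, (Set.univ.pi s).indicator (fun z => ENNReal.ofReal (Real.exp ((∑ i, (x i - y i) * z i
        - (∑ i, (x i ^ 2 - y i ^ 2)) / 2) / v))) z = ∏ i, g i (z i) := by
    intro z
    by_cases hz : z ∈ Set.univ.pi s
    · rw [Set.indicator_of_mem hz]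
      have : ∀ i, g i (z i) = ENNReal.ofReal (Real.exp (((x i - y i) * z i - (x i ^ 2 - y i ^ 2) / 2) / v)) :=
        fun i => Set.indicator_of_mem (hz i trivial) _
      simp_rw [this]
      rw [← ENNReal.ofReal_prod_of_nonneg (fun _ _ => (Real.exp_pos _).le), ← Real.exp_sum,
        ← Finset.sum_div, Finset.sum_sub_distrib (fun i => (x i - y i) * z i), Finset.sum_div]
    · rw [Set.indicator_of_notMem hz]
      simp only [Set.mem_pi, Set.mem_univ, true_imp_iff, not_forall] at hz
      obtain ⟨i, hi⟩ := hz
      symm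
      exact Finset.prod_eq_zero (Finset.mem_univ i) (Set.indicator_of_notMem hi _)
  simp_rw [e]
  have hind := iIndepFun_pi (μ := fun i => gaussianReal (y i) v) (X := g) (fun i => (hgm i).aemeasurable)
  have := lintegral_prod_eq_prod_lintegral_of_indepFun Finset.univ (fun i (z : Fin d → ℝ) => g i (z i)) hind
    (fun i => (hgm i).comp (measurable_pi_apply i))
  rw [this]
  apply Finset.prod_congr rfl
  intro i _
  rw [(measurePreserving_eval (fun i => gaussianReal (y i) v) i).lintegral_comp (hgm i),
    lintegral_indicator (hs i), gauss_tilt (x i) (y i) v hv, withDensity_apply _ (hs i)]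

lemma gaussPi_map (d : ℕ) (m w : Fin d → ℝ) (v : NNReal) :
    (gaussPi d m v).map (fun z => ∑ i, w i * z i)
      = gaussianReal (∑ i, w i * m i) (Real.toNNReal (v * ∑ i, w i ^ 2)) := by
  unfold gaussPi
  have hml : ∀ i, MemLp (fun z : ℝ => w i * z) 2 (gaussianReal (m i) v) :=
    fun i => (memLp_id_gaussianReal' 2 (by norm_num)).const_mul (w i)
  have hind := iIndepFun_pi (μ := fun i => gaussianReal (m i) v) (X := fun i z => w i * z)
    (fun i => by fun_prop)
  have hG : HasGaussianLaw (fun z : Fin d → ℝ => ∑ i, w i * z i)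
      (Measure.pi fun i => gaussianReal (m i) v) := by
    refine iIndepFun.hasGaussianLaw_fun_sum (fun i => ?_) hind
    constructor
    have : (fun z : Fin d → ℝ => w i * z i) = (fun u => w i * u) ∘ (Function.eval i) := rfl
    rw [this, ← Measure.map_map (by fun_prop) (by fun_prop),
      (measurePreserving_eval (fun i => gaussianReal (m i) v) i).map_eq, gaussianReal_map_const_mul]
    infer_instance
  rw [hG.map_eq_gaussianReal]
  congr 1
  · rw [integral_finsetSum]
    · apply Finset.sum_congr rfl
      intro i _
      rw [integral_comp_eval (μ := fun i => gaussianReal (m i) v) (i := i) (f := fun z => w i * z) (by fun_prop),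
        integral_const_mul, integral_id_gaussianReal]
    · intro i _
      exact (measurePreserving_eval (fun i => gaussianReal (m i) v) i).integrable_comp_of_integrable
        ((hml i).integrable (by norm_num))
  · congr 1
    have := variance_sum_pi hml
    rw [show (fun z : Fin d → ℝ => ∑ i, w i * z i) = ∑ i, fun z : Fin d → ℝ => w i * z i by
      ext z; simp, this, Finset.mul_sum]
    apply Finset.sum_congr rfl
    intro i _
    rw [variance_const_mul, variance_fun_id_gaussianReal]; ring

lemma gaussPi_half (d : ℕ) (m w : Fin d → ℝ) (σ Δ t : ℝ) (hσ : 0 < σ) (hΔ : 0 < Δ)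
    (hw : ∑ i, w i ^ 2 = Δ ^ 2) :
    gaussPi d m (Real.toNNReal (σ ^ 2)) {z | t < ∑ i, w i * z i}
      = ENNReal.ofReal ((1/2) * erfc ((t - ∑ i, w i * m i) / (σ * Δ * Real.sqrt 2))) := by
  rw [← gauss_tail_s2 (∑ i, w i * m i) (σ * Δ) t (by positivity)
    (Real.toNNReal ((Real.toNNReal (σ ^ 2)) * ∑ i, w i ^ 2)), ← gaussPi_map,
    Measure.map_apply (by fun_prop) measurableSet_Ioi]
  · rfl
  · rw [hw, Real.coe_toNNReal _ (sq_nonneg σ), Real.coe_toNNReal _ (by positivity)]; ring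

lemma main_eq (d : ℕ) (σ Δ : ℝ) (hσ : 0 < σ) (hΔ : 0 < Δ)
    (x y : Fin d → ℝ) (hsens : ∑ j, (x j - y j) ^ 2 = Δ ^ 2)
    (μ : ℝ) (hμ : μ = Δ ^ 2 / (2 * σ ^ 2))
    (ε : ℝ) (S : Set (Fin d → ℝ)) (hS : MeasurableSet S) :
    gaussPi d x (Real.toNNReal (σ ^ 2)) S
      ≤ ENNReal.ofReal (Real.exp ε) * gaussPi d y (Real.toNNReal (σ ^ 2)) S
        + ENNReal.ofReal ((1 / 2) * (erfc ((ε - μ) / (2 * Real.sqrt μ))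
            - Real.exp ε * erfc ((ε + μ) / (2 * Real.sqrt μ)))) := by
  have hv : Real.toNNReal (σ ^ 2) ≠ 0 := by
    rw [Ne, Real.toNNReal_eq_zero, not_le]; positivity
  have htilt := gaussPi_tilt d x y _ hv
  set c : ℝ := σ ^ 2 * ε + (∑ i, (x i ^ 2 - y i ^ 2)) / 2 with hc
  have hP := gaussPi_half d x (fun i => x i - y i) σ Δ c hσ hΔ hsens
  have hQ := gaussPi_half d y (fun i => x i - y i) σ Δ c hσ hΔ hsens
  have hsq : Real.sqrt μ = Δ / (σ * Real.sqrt 2) := by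
    rw [hμ, Real.sqrt_div (by positivity), Real.sqrt_mul (by norm_num), Real.sqrt_sq hΔ.le,
      Real.sqrt_sq hσ.le, mul_comm]
  have h2 : Real.sqrt 2 ^ 2 = 2 := Real.sq_sqrt (by norm_num)
  have h20 : 0 < Real.sqrt 2 := by positivity
  have e1 : c - ∑ i, (x i - y i) * x i = σ ^ 2 * (ε - μ) := by
    have : ∑ i, (x i - y i) * x i = (∑ i, (x i ^ 2 - y i ^ 2)) / 2 + (∑ j, (x j - y j) ^ 2) / 2 := by
      rw [← add_div, ← Finset.sum_add_distrib, Finset.sum_div]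
      exact Finset.sum_congr rfl fun i _ => by ring
    rw [this, hsens, hc, hμ]; field_simp; ring
  have e2 : c - ∑ i, (x i - y i) * y i = σ ^ 2 * (ε + μ) := by
    have : ∑ i, (x i - y i) * y i = (∑ i, (x i ^ 2 - y i ^ 2)) / 2 - (∑ j, (x j - y j) ^ 2) / 2 := by
      rw [← sub_div, ← Finset.sum_sub_distrib, Finset.sum_div]
      exact Finset.sum_congr rfl fun i _ => by ring
    rw [this, hsens, hc, hμ]; field_simp; ring
  have e3 : ∀ r : ℝ, σ ^ 2 * r / (σ * Δ * Real.sqrt 2) = r / (2 * Real.sqrt μ) := by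
    intro r
    rw [hsq]; field_simp; rw [h2]
  rw [e1, e3] at hP
  rw [e2, e3] at hQ
  have herf : ∀ r, 0 ≤ erfc r := fun r => by
    unfold erfc
    exact mul_nonneg (by positivity) (integral_nonneg fun _ => (Real.exp_pos _).le)
  set A : Set (Fin d → ℝ) := {z | c < ∑ i, (x i - y i) * z i} with hA
  have hAm : MeasurableSet A := measurableSet_lt (by fun_prop) (by fun_prop)
  set P := gaussPi d x (Real.toNNReal (σ ^ 2)) with hPdef
  set Q := gaussPi d y (Real.toNNReal (σ ^ 2)) with hQdef
  have : IsProbabilityMeasure P := by rw [hPdef]; unfold gaussPi; infer_instance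
  have : IsProbabilityMeasure Q := by rw [hQdef]; unfold gaussPi; infer_instance
  have hσv : ((Real.toNNReal (σ ^ 2) : NNReal) : ℝ) = σ ^ 2 := Real.coe_toNNReal _ (sq_nonneg σ)
  have h1 : P (S \ A) ≤ ENNReal.ofReal (Real.exp ε) * Q (S \ A) := by
    rw [htilt, withDensity_apply _ (hS.diff hAm), ← setLIntegral_const]
    refine setLIntegral_mono' (hS.diff hAm) fun z hz => ?_
    apply ENNReal.ofReal_le_ofReal
    apply Real.exp_le_exp.2
    have : ¬ (c < ∑ i, (x i - y i) * z i) := hz.2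
    rw [hσv, div_le_iff₀ (by positivity)]
    linarith
  have h3 : ENNReal.ofReal (Real.exp ε) * Q (A \ S) ≤ P (A \ S) := by
    rw [htilt, withDensity_apply _ (hAm.diff hS), ← setLIntegral_const]
    refine setLIntegral_mono' (hAm.diff hS) fun z hz => ?_
    apply ENNReal.ofReal_le_ofReal
    apply Real.exp_le_exp.2
    have : (c < ∑ i, (x i - y i) * z i) := hz.1
    rw [hσv, le_div_iff₀ (by positivity)]
    linarith
  have hPr : P.real A = (1/2) * erfc ((ε - μ) / (2 * Real.sqrt μ)) := by
    rw [measureReal_def, hP, ENNReal.toReal_ofReal (mul_nonneg (by norm_num) (herf _))]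
  have hQr : Q.real A = (1/2) * erfc ((ε + μ) / (2 * Real.sqrt μ)) := by
    rw [measureReal_def, hQ, ENNReal.toReal_ofReal (mul_nonneg (by norm_num) (herf _))]
  have h1r : P.real (S \ A) ≤ Real.exp ε * Q.real (S \ A) := by
    have := ENNReal.toReal_mono (by finiteness) h1
    rwa [ENNReal.toReal_mul, ENNReal.toReal_ofReal (Real.exp_pos _).le] at this
  have h3r : Real.exp ε * Q.real (A \ S) ≤ P.real (A \ S) := by
    have := ENNReal.toReal_mono (by finiteness) h3
    rwa [ENNReal.toReal_mul, ENNReal.toReal_ofReal (Real.exp_pos _).le] at this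
  have a1 := measureReal_inter_add_sdiff (μ := P) (s := S) hAm
  have a2 := measureReal_inter_add_sdiff (μ := Q) (s := S) hAm
  have a3 := measureReal_inter_add_sdiff (μ := P) (s := A) hS
  have a4 := measureReal_inter_add_sdiff (μ := Q) (s := A) hS
  rw [Set.inter_comm] at a3 a4
  have key : P.real S ≤ Real.exp ε * Q.real S + (1 / 2) * (erfc ((ε - μ) / (2 * Real.sqrt μ))
            - Real.exp ε * erfc ((ε + μ) / (2 * Real.sqrt μ))) := by
    have : (1 / 2) * (erfc ((ε - μ) / (2 * Real.sqrt μ))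
            - Real.exp ε * erfc ((ε + μ) / (2 * Real.sqrt μ))) = P.real A - Real.exp ε * Q.real A := by
      rw [hPr, hQr]; ring
    rw [this, ← a1, ← a2, ← a3, ← a4]
    linarith
  calc P S = ENNReal.ofReal (P.real S) := (ofReal_measureReal (by finiteness)).symm
    _ ≤ _ := ENNReal.ofReal_le_ofReal key
    _ ≤ _ := ENNReal.ofReal_add_le
    _ = _ := by rw [ENNReal.ofReal_mul (Real.exp_pos _).le, ofReal_measureReal (by finiteness)]

lemma gaussPi_tail (d : ℕ) (a : ℝ) (x : Fin d → ℝ) (v : NNReal) (S : Set (Fin d → ℝ)) (hS : MeasurableSet S) :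
    gaussPi (d + 1) (Fin.cons a x) v ((fun z i => z (Fin.succ i)) ⁻¹' S) = gaussPi d x v S := by
  unfold gaussPi
  have h := measurePreserving_piFinSuccAbove (α := fun _ => ℝ)
    (fun j : Fin (d + 1) => gaussianReal ((Fin.cons a x : Fin (d + 1) → ℝ) j) v) 0
  have h' := measurePreserving_snd.comp h
  have := h'.measure_preimage hS.nullMeasurableSet
  simp only [Fin.zero_succAbove, Fin.cons_succ] at this
  exact this

/-- Tight ADP guarantee of a single Gaussian mechanism with ℓ₂-sensitivity `Δ` and
noise variance `σ²`. -/
theorem gaussian_mechanism_is_ADP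
    (d : ℕ) (σ Δ : ℝ) (hσ : 0 < σ) (hΔ : 0 < Δ)
    (x y : Fin d → ℝ) (hsens : Real.sqrt (∑ j, (x j - y j) ^ 2) ≤ Δ)
    (μ : ℝ) (hμ : μ = Δ ^ 2 / (2 * σ ^ 2))
    (ε : ℝ) (hε : 0 ≤ ε) (S : Set (Fin d → ℝ)) (hS : MeasurableSet S) :
    gaussPi d x (Real.toNNReal (σ ^ 2)) S
      ≤ ENNReal.ofReal (Real.exp ε) * gaussPi d y (Real.toNNReal (σ ^ 2)) S
        + ENNReal.ofReal ((1 / 2) * (erfc ((ε - μ) / (2 * Real.sqrt μ))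
            - Real.exp ε * erfc ((ε + μ) / (2 * Real.sqrt μ)))) := by
  have hle : ∑ j, (x j - y j) ^ 2 ≤ Δ ^ 2 := (Real.sqrt_le_left hΔ.le).1 hsens
  rw [← gaussPi_tail d (Real.sqrt (Δ ^ 2 - ∑ j, (x j - y j) ^ 2)) x _ S hS,
    ← gaussPi_tail d 0 y _ S hS]
  refine main_eq (d + 1) σ Δ hσ hΔ _ _ ?_ μ hμ ε _ (hS.preimage (by fun_prop))
  rw [Fin.sum_univ_succ]
  simp only [Fin.cons_zero, Fin.cons_succ, sub_zero]
  rw [Real.sq_sqrt (by linarith)]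
  ring
end

section
/- Let U : ℝ^d → ℝ be differentiable with gradient ∇U, let M be a positive definite d×d real matrix, let η > 0 and L ≥ 1, and assume ∫_{ℝ^d} e^{−U(θ)} dθ < ∞. Define H(θ, p) = U(θ) + ½ pᵀM⁻¹p, the leapfrog steps l_{p,s}(θ, p) = (θ, p − s∇U(θ)) and l_θ(θ, p) = (θ + ηM⁻¹p, p), the L-step leapfrog map l = l_{p,η/2} ∘ l_θ ∘ (l_{p,η} ∘ l_θ)^{L−1} ∘ l_{p,η/2}, the momentum flip l_−(θ, p) = (θ, −p), and Φ = l_− ∘ l. Let π* be the probability measure on ℝ^{2d} with density proportional to exp(−H(θ, p)) with respect to the Lebesgue measure, and let K be the Metropolis–Hastings kernel with deterministic proposal Φ and acceptance probability α(x) = min{1, exp(H(x) − H(Φ(x)))}, i.e., K(x, A) = α(x) 1_A(Φ(x)) + (1 − α(x)) 1_A(x). Then π* is invariant for K, i.e., ∫ K(x, A) π*(dx) = π*(A) for every measurable A ⊆ ℝ^{2d}. -/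
open MeasureTheory Matrix

/-- Momentum leapfrog step `l_{p,s}(θ, p) = (θ, p − s ∇U(θ))`, with `gU = ∇U`. -/
def leapfrogP (d : ℕ) (gU : (Fin d → ℝ) → (Fin d → ℝ)) (s : ℝ) :
    (Fin d → ℝ) × (Fin d → ℝ) → (Fin d → ℝ) × (Fin d → ℝ) :=
  fun x => (x.1, x.2 - s • gU x.1)

/-- Position leapfrog step `l_θ(θ, p) = (θ + ηM⁻¹p, p)`. -/
noncomputable def leapfrogTheta (d : ℕ) (M : Matrix (Fin d) (Fin d) ℝ) (η : ℝ) :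
    (Fin d → ℝ) × (Fin d → ℝ) → (Fin d → ℝ) × (Fin d → ℝ) :=
  fun x => (x.1 + η • M⁻¹.mulVec x.2, x.2)

/-- The `L`-step leapfrog map `l = l_{p,η/2} ∘ l_θ ∘ (l_{p,η} ∘ l_θ)^{L−1} ∘ l_{p,η/2}`. -/
noncomputable def leapfrog (d : ℕ) (gU : (Fin d → ℝ) → (Fin d → ℝ))
    (M : Matrix (Fin d) (Fin d) ℝ) (η : ℝ) (L : ℕ) :
    (Fin d → ℝ) × (Fin d → ℝ) → (Fin d → ℝ) × (Fin d → ℝ) :=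
  leapfrogP d gU (η / 2) ∘ leapfrogTheta d M η ∘
    (leapfrogP d gU η ∘ leapfrogTheta d M η)^[L - 1] ∘ leapfrogP d gU (η / 2)

/-- The momentum flip `l_−(θ, p) = (θ, −p)`. -/
def momentumFlip (d : ℕ) : (Fin d → ℝ) × (Fin d → ℝ) → (Fin d → ℝ) × (Fin d → ℝ) :=
  fun x => (x.1, -x.2)

/-- The Hamiltonian `H(θ, p) = U(θ) + ½ pᵀM⁻¹p`. -/
noncomputable def hamiltonian (d : ℕ) (U : (Fin d → ℝ) → ℝ) (M : Matrix (Fin d) (Fin d) ℝ)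
    (x : (Fin d → ℝ) × (Fin d → ℝ)) : ℝ :=
  U x.1 + (1 / 2) * (x.2 ⬝ᵥ M⁻¹.mulVec x.2)

def HmcRev {X : Type*} (F f g : X → X) : Prop := ∀ x, F (f (F (g x))) = x

theorem HmcRev.comp {X : Type*} {F f g f' g' : X → X} (hF : ∀ x, F (F x) = x)
    (h : HmcRev F f g) (h' : HmcRev F f' g') : HmcRev F (f ∘ f') (g' ∘ g) := by
  intro x
  have h1 : f' (F (g' (g x))) = F (g x) := by
    rw [← hF (f' (F (g' (g x)))), h' (g x)]
  simp only [Function.comp]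
  rw [h1, h x]

theorem HmcRev.iter {X : Type*} {F f g : X → X} (hF : ∀ x, F (F x) = x)
    (h : HmcRev F f g) (n : ℕ) : HmcRev F (f^[n]) (g^[n]) := by
  induction n with
  | zero => intro x; simp [hF]
  | succ n ih =>
    rw [Function.iterate_succ, Function.iterate_succ']
    exact HmcRev.comp hF ih h

theorem hmc_rev_word {X : Type*} {F a T P : X → X} (hF : ∀ x, F (F x) = x)
    (ha : HmcRev F a a) (hT : HmcRev F T T) (hP : HmcRev F P P) (n : ℕ) :
    HmcRev F (a ∘ T ∘ (P ∘ T)^[n] ∘ a) (a ∘ T ∘ (P ∘ T)^[n] ∘ a) := by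
  have h1 : HmcRev F ((P ∘ T)^[n]) ((T ∘ P)^[n]) := (hP.comp hF hT).iter hF n
  have h2 := hT.comp hF h1
  have hs : (T ∘ P)^[n] ∘ T = T ∘ (P ∘ T)^[n] := by
    have : Function.Semiconj T (P ∘ T) (T ∘ P) := fun x => rfl
    exact ((this.iterate_right n).comp_eq).symm
  rw [hs] at h2
  have h3 := HmcRev.comp hF ha (HmcRev.comp hF h2 ha)
  exact h3

theorem hmc_mp_P (d : ℕ) (gU : (Fin d → ℝ) → (Fin d → ℝ)) (hg : Measurable gU) (s : ℝ) :
    MeasurePreserving (leapfrogP d gU s) volume volume := by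
  refine MeasurePreserving.skew_product (f := id)
    (g := fun (a b : Fin d → ℝ) => b - s • gU a) (MeasurePreserving.id volume) ?_ ?_
  · exact measurable_snd.sub ((hg.comp measurable_fst).const_smul s)
  · exact Filter.Eventually.of_forall fun a =>
      (measurePreserving_sub_right volume (s • gU a)).map_eq

theorem hmc_mp_T (d : ℕ) (M : Matrix (Fin d) (Fin d) ℝ) (η : ℝ) :
    MeasurePreserving (leapfrogTheta d M η) volume volume := by
  have hc : Measurable fun p : Fin d → ℝ => M⁻¹.mulVec p :=
    (Continuous.matrix_mulVec continuous_const continuous_id).measurable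
  have h1 : MeasurePreserving (fun x : (Fin d → ℝ) × (Fin d → ℝ) =>
      (x.1, x.2 + η • M⁻¹.mulVec x.1)) volume volume := by
    refine MeasurePreserving.skew_product (f := id)
      (g := fun (a b : Fin d → ℝ) => b + η • M⁻¹.mulVec a) (MeasurePreserving.id volume) ?_ ?_
    · exact measurable_snd.add ((hc.comp measurable_fst).const_smul η)
    · exact Filter.Eventually.of_forall fun a =>
        (measurePreserving_add_right volume (η • M⁻¹.mulVec a)).map_eq
  have hs : MeasurePreserving (Prod.swap : (Fin d → ℝ) × (Fin d → ℝ) → _) volume volume :=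
    Measure.measurePreserving_swap
  exact hs.comp (h1.comp hs)

theorem hmc_mp_F (d : ℕ) : MeasurePreserving (momentumFlip d) volume volume :=
  (MeasurePreserving.id volume).prod (Measure.measurePreserving_neg volume)

theorem hmc_meas_grad (d : ℕ) (U : (Fin d → ℝ) → ℝ) (gU : (Fin d → ℝ) → (Fin d → ℝ))
    (hgrad : ∀ θ, HasFDerivAt U
      (∑ i : Fin d, gU θ i • (ContinuousLinearMap.proj i : (Fin d → ℝ) →L[ℝ] ℝ)) θ) :
    Measurable gU := by
  refine measurable_pi_lambda _ fun i => ?_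
  have : (fun θ => gU θ i) = fun θ => fderiv ℝ U θ (Pi.single i 1) := by
    funext θ
    rw [(hgrad θ).fderiv]
    simp [Pi.single_apply]
  rw [this]
  exact measurable_fderiv_apply_const ℝ U _

/-- HMC with the flipped-leapfrog proposal `Φ = l_− ∘ l` and acceptance probability
`α(x) = min {1, exp (H x − H (Φ x))}` leaves the target `π* ∝ exp (−H)` invariant
(Theorem `hmc_convergence_theorem`). Here `gU θ` is the gradient of the differentiable `U` at `θ`
with respect to the Euclidean inner product. -/
theorem hmc_invariant_distribution
    (d : ℕ) (U : (Fin d → ℝ) → ℝ) (gU : (Fin d → ℝ) → (Fin d → ℝ))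
    (hgrad : ∀ θ, HasFDerivAt U
      (∑ i : Fin d, gU θ i • (ContinuousLinearMap.proj i : (Fin d → ℝ) →L[ℝ] ℝ)) θ)
    (M : Matrix (Fin d) (Fin d) ℝ) (hM : M.PosDef)
    (η : ℝ) (hη : 0 < η) (L : ℕ) (hL : 1 ≤ L)
    (hUint : ∫⁻ θ, ENNReal.ofReal (Real.exp (-U θ)) < ⊤)
    (Φ : (Fin d → ℝ) × (Fin d → ℝ) → (Fin d → ℝ) × (Fin d → ℝ))
    (hΦ : Φ = momentumFlip d ∘ leapfrog d gU M η L)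
    (H : (Fin d → ℝ) × (Fin d → ℝ) → ℝ) (hH : H = hamiltonian d U M)
    (α : (Fin d → ℝ) × (Fin d → ℝ) → ℝ)
    (hα : ∀ x, α x = min 1 (Real.exp (H x - H (Φ x))))
    (πstar : Measure ((Fin d → ℝ) × (Fin d → ℝ)))
    (hπ : πstar = (∫⁻ x, ENNReal.ofReal (Real.exp (-H x)))⁻¹
      • volume.withDensity fun x => ENNReal.ofReal (Real.exp (-H x)))
    (K : (Fin d → ℝ) × (Fin d → ℝ) → Set ((Fin d → ℝ) × (Fin d → ℝ)) → ENNReal)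
    (hK : ∀ x A, K x A = ENNReal.ofReal (α x) * A.indicator (fun _ => (1 : ENNReal)) (Φ x)
      + ENNReal.ofReal (1 - α x) * A.indicator (fun _ => (1 : ENNReal)) x)
    (A : Set ((Fin d → ℝ) × (Fin d → ℝ))) (hA : MeasurableSet A) :
    ∫⁻ x, K x A ∂πstar = πstar A := by
  have hg := hmc_meas_grad d U gU hgrad
  have hFF : ∀ x, momentumFlip d (momentumFlip d x) = x := fun x => by simp [momentumFlip]
  have hPr : ∀ s, HmcRev (momentumFlip d) (leapfrogP d gU s) (leapfrogP d gU s) := fun s x => by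
    ext <;> simp [momentumFlip, leapfrogP]
  have hTr : HmcRev (momentumFlip d) (leapfrogTheta d M η) (leapfrogTheta d M η) := fun x => by
    ext <;> simp [momentumFlip, leapfrogTheta, Matrix.mulVec_neg]
  have hinv : ∀ x, Φ (Φ x) = x := by
    intro x
    rw [hΦ]
    exact hmc_rev_word hFF (hPr (η / 2)) hTr (hPr η) (L - 1) x
  have hmp : MeasurePreserving Φ volume volume := by
    rw [hΦ]
    exact (hmc_mp_F d).comp ((hmc_mp_P d gU hg _).comp ((hmc_mp_T d M η).comp
      ((((hmc_mp_P d gU hg _).comp (hmc_mp_T d M η)).iterate _).comp (hmc_mp_P d gU hg _))))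
  have hUc : Continuous U := continuous_iff_continuousAt.2 fun θ => (hgrad θ).continuousAt
  have hHm : Measurable H := by
    rw [hH]
    refine Continuous.measurable ?_
    unfold hamiltonian
    exact (hUc.comp continuous_fst).add (continuous_const.mul
      (continuous_snd.dotProduct (Continuous.matrix_mulVec continuous_const continuous_snd)))
  have hαm : Measurable α := by
    have : α = fun x => min 1 (Real.exp (H x - H (Φ x))) := funext hα
    rw [this]
    exact measurable_const.min (hHm.sub (hHm.comp hmp.measurable)).exp
  set f : (Fin d → ℝ) × (Fin d → ℝ) → ENNReal := fun x => ENNReal.ofReal (Real.exp (-H x)) with hf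
  have hfm : Measurable f := hHm.neg.exp.ennreal_ofReal
  set m : (Fin d → ℝ) × (Fin d → ℝ) → ENNReal := fun x => f x * ENNReal.ofReal (α x) with hm
  have hmm : Measurable m := hfm.mul hαm.ennreal_ofReal
  have hmin : ∀ x, m x = ENNReal.ofReal (min (Real.exp (-H x)) (Real.exp (-H (Φ x)))) := by
    intro x
    simp only [hm, hf]
    rw [← ENNReal.ofReal_mul (Real.exp_pos _).le, hα, mul_min_of_nonneg _ _ (Real.exp_pos _).le,
      mul_one, ← Real.exp_add]
    congr 3
    ring
  have hmΦ : ∀ x, m (Φ x) = m x := by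
    intro x
    rw [hmin, hmin, hinv, min_comm]
  have hα0 : ∀ x, 0 ≤ α x := fun x => by
    rw [hα]; exact le_min zero_le_one (Real.exp_pos _).le
  have hα1 : ∀ x, α x ≤ 1 := fun x => by rw [hα]; exact min_le_left _ _
  set I : (Fin d → ℝ) × (Fin d → ℝ) → ENNReal := A.indicator (fun _ => (1 : ENNReal)) with hI
  have hIm : Measurable I := measurable_const.indicator hA
  have hKm : Measurable fun x => K x A := by
    have : (fun x => K x A) = fun x => ENNReal.ofReal (α x) * I (Φ x)
        + ENNReal.ofReal (1 - α x) * I x := funext fun x => hK x A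
    rw [this]
    exact (hαm.ennreal_ofReal.mul (hIm.comp hmp.measurable)).add
      ((measurable_const.sub hαm).ennreal_ofReal.mul hIm)
  have key : ∫⁻ x, f x * K x A = ∫⁻ x, f x * I x := by
    have e1 : ∀ x, f x * K x A = m (Φ x) * I (Φ x) + f x * ENNReal.ofReal (1 - α x) * I x := by
      intro x
      rw [hK, hmΦ]
      simp only [hm]
      ring
    have e2 : ∀ x, f x * I x = m x * I x + f x * ENNReal.ofReal (1 - α x) * I x := by
      intro x
      simp only [hm]
      rw [← add_mul, ← mul_add, ← ENNReal.ofReal_add (hα0 x) (sub_nonneg.2 (hα1 x))]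
      simp
    simp_rw [e1, e2]
    have hmI : Measurable fun x => m x * I x := hmm.mul hIm
    have hmI2 : Measurable fun x => m (Φ x) * I (Φ x) := hmI.comp hmp.measurable
    rw [lintegral_add_left hmI2, lintegral_add_left hmI]
    congr 1
    exact hmp.lintegral_comp (hmm.mul hIm)
  rw [hπ, lintegral_smul_measure, Measure.smul_apply,
    lintegral_withDensity_eq_lintegral_mul _ hfm hKm, withDensity_apply _ hA]
  congr 1
  rw [← lintegral_indicator hA]
  refine Eq.trans key (lintegral_congr fun x => ?_)
  by_cases hx : x ∈ A <;> simp [hI, hx]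
end

section
/- Let f : ℝ^d → ℝ^d be measurable and let σ > 0. Define the Markov kernel K on ℝ^d × ℝ^d by letting K((θ, p), ·) be the law of (θ, −p + f(θ) + σZ) where Z ∼ N(0, I_d), i.e., K((θ, p), ·) = δ_θ ⊗ N(−p + f(θ), σ²I_d). Then K is reversible with respect to the Lebesgue measure on ℝ^{2d}. In particular, each noisy flipped momentum step l⁻_{p,s} of DP-HMC, which maps (θ, p) to (θ, −p + s(g(θ) + ξ)) with ξ ∼ N(0, σ_g²I_d), is reversible with respect to the Lebesgue measure. -/
open MeasureTheory ProbabilityTheory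

/-- A Markov kernel `q` is reversible with respect to a measure `μ` if
`∫_A μ(da) ∫_B q(a, db) = ∫_B μ(db) ∫_A q(b, da)` for all measurable sets `A`, `B`. -/
def Reversible {E : Type*} [MeasurableSpace E] (q : Kernel E E) (μ : Measure E) : Prop :=
  ∀ A B : Set E, MeasurableSet A → MeasurableSet B →
    ∫⁻ a in A, q a B ∂μ = ∫⁻ b in B, q b A ∂μ

theorem gaussPi_eq_map (d : ℕ) (m : Fin d → ℝ) (v : NNReal) :
    gaussPi d m v = (gaussPi d 0 v).map (fun z => m + z) := by
  have h := Measure.pi_map_pi (μ := fun _ : Fin d => gaussianReal 0 v)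
    (f := fun i x => m i + x) (hf := fun i => (measurable_const_add (m i)).aemeasurable)
  have e : (fun z : Fin d → ℝ => m + z) = fun x i => m i + x i := rfl
  unfold gaussPi
  rw [e]
  simp only [Pi.zero_apply]
  rw [h]
  congr 1
  funext i
  rw [gaussianReal_map_const_add, zero_add]

instance gaussPi_prob (d : ℕ) (m : Fin d → ℝ) (v : NNReal) :
    IsProbabilityMeasure (gaussPi d m v) := by
  unfold gaussPi; infer_instance

theorem kernel_side (d : ℕ) (f : (Fin d → ℝ) → (Fin d → ℝ)) (hf : Measurable f) (v : NNReal)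
    (K : Kernel ((Fin d → ℝ) × (Fin d → ℝ)) ((Fin d → ℝ) × (Fin d → ℝ)))
    (hK : ∀ θ p, K (θ, p) = (Measure.dirac θ).prod (gaussPi d (-p + f θ) v))
    (A B : Set ((Fin d → ℝ) × (Fin d → ℝ))) (hA : MeasurableSet A) (hB : MeasurableSet B) :
    ∫⁻ a in A, K a B = ∫⁻ θ : Fin d → ℝ, ∫⁻ z, ∫⁻ p : Fin d → ℝ,
      A.indicator 1 (θ, p) * B.indicator 1 (θ, -p + f θ + z) ∂volume ∂(gaussPi d 0 v) := by
  have hKB : ∀ θ p, K (θ, p) B = ∫⁻ z, B.indicator 1 (θ, -p + f θ + z) ∂(gaussPi d 0 v) := by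
    intro θ p
    rw [hK, ← lintegral_indicator_one hB, Measure.dirac_prod,
      lintegral_map (measurable_one.indicator hB) (by fun_prop), gaussPi_eq_map,
      lintegral_map (by exact (measurable_one.indicator hB).comp (by fun_prop)) (by fun_prop)]
  rw [← lintegral_indicator hA, Measure.volume_eq_prod, lintegral_prod _
    ((K.measurable_coe hB).indicator hA).aemeasurable]
  refine lintegral_congr fun θ => ?_
  have mB : Measurable (B.indicator (1 : (Fin d → ℝ) × (Fin d → ℝ) → ENNReal)) := measurable_one.indicator hB
  have mA : Measurable (A.indicator (1 : (Fin d → ℝ) × (Fin d → ℝ) → ENNReal)) := measurable_one.indicator hA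
  rw [lintegral_lintegral_swap]
  · refine lintegral_congr fun p => ?_
    rw [lintegral_const_mul _ (by exact mB.comp (by fun_prop)), ← hKB]
    by_cases h : (θ, p) ∈ A <;> simp [h]
  · apply Measurable.aemeasurable
    apply Measurable.mul
    · exact mA.comp (by fun_prop)
    · exact mB.comp (by fun_prop)

/-- The noisy flipped momentum step of DP-HMC, the Markov kernel sending `(θ, p)` to the law of
`(θ, −p + f(θ) + σZ)` with `Z ∼ N(0, I_d)`, i.e. `K((θ, p), ·) = δ_θ ⊗ N(−p + f(θ), σ²I_d)`,
is reversible with respect to the Lebesgue measure on `ℝ^{2d}`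
(Lemma `dp_hmc_leapfrog_step_reversibility_lemma`). -/
theorem noisy_momentum_step_reversible
    (d : ℕ) (f : (Fin d → ℝ) → (Fin d → ℝ)) (hf : Measurable f)
    (σ : ℝ) (hσ : 0 < σ)
    (K : Kernel ((Fin d → ℝ) × (Fin d → ℝ)) ((Fin d → ℝ) × (Fin d → ℝ)))
    [IsMarkovKernel K]
    (hK : ∀ θ p, K (θ, p)
      = (Measure.dirac θ).prod (gaussPi d (-p + f θ) (Real.toNNReal (σ ^ 2)))) :
    Reversible K (volume : Measure ((Fin d → ℝ) × (Fin d → ℝ))) := by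
  intro A B hA hB
  rw [kernel_side d f hf _ K hK A B hA hB, kernel_side d f hf _ K hK B A hB hA]
  refine lintegral_congr fun θ => lintegral_congr fun z => ?_
  rw [← lintegral_sub_left_eq_self _ (f θ + z)]
  refine lintegral_congr fun p => ?_
  have e1 : -(f θ + z - p) + f θ + z = p := by abel
  have e2 : f θ + z - p = -p + f θ + z := by abel
  rw [e1, e2, mul_comm]
end

section
/- Let M be a positive definite d×d real matrix and η > 0. Define the map F : ℝ^d × ℝ^d → ℝ^d × ℝ^d by F(θ, p) = (θ − ηM⁻¹p, −p) (this is l_θ ∘ l_− where l_θ(θ, p) = (θ + ηM⁻¹p, p) and l_−(θ, p) = (θ, −p)). Then the Dirac Markov kernel q((θ, p), B) = δ_{F(θ,p)}(B) is reversible with respect to the Lebesgue measure on ℝ^{2d}. -/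
open MeasureTheory ProbabilityTheory Matrix

/-- The Dirac Markov kernel of the map `F = l_θ ∘ l_−`, `F(θ, p) = (θ − ηM⁻¹p, −p)`, is
reversible with respect to the Lebesgue measure on `ℝ^{2d}`. -/
theorem flipped_position_step_reversible
    (d : ℕ) (M : Matrix (Fin d) (Fin d) ℝ) (hM : M.PosDef) (η : ℝ) (hη : 0 < η)
    (q : Kernel ((Fin d → ℝ) × (Fin d → ℝ)) ((Fin d → ℝ) × (Fin d → ℝ)))
    [IsMarkovKernel q]
    (hq : ∀ θ p : Fin d → ℝ, q (θ, p) = Measure.dirac (θ - η • M⁻¹.mulVec p, -p)) :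
    Reversible q (volume : Measure ((Fin d → ℝ) × (Fin d → ℝ))) := by
  set F : (Fin d → ℝ) × (Fin d → ℝ) → (Fin d → ℝ) × (Fin d → ℝ) :=
    fun x => (x.1 - η • M⁻¹.mulVec x.2, -x.2) with hF
  have hinv : ∀ x, F (F x) = x := by
    rintro ⟨θ, p⟩
    simp [hF, Matrix.mulVec_neg]
  have hcont : Continuous fun p : Fin d → ℝ => η • M⁻¹.mulVec p :=
    (Continuous.matrix_mulVec continuous_const continuous_id).const_smul η
  have hskew : MeasurePreserving
      (fun x : (Fin d → ℝ) × (Fin d → ℝ) => (-x.1, x.2 - η • M⁻¹.mulVec x.1))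
      ((volume : Measure (Fin d → ℝ)).prod (volume : Measure (Fin d → ℝ)))
      ((volume : Measure (Fin d → ℝ)).prod (volume : Measure (Fin d → ℝ))) := by
    refine MeasurePreserving.skew_product
      (g := fun p θ : Fin d → ℝ => θ - η • M⁻¹.mulVec p)
      (Measure.measurePreserving_neg (volume : Measure (Fin d → ℝ))) ?_ ?_
    · exact (continuous_snd.sub (hcont.comp continuous_fst)).measurable
    · exact Filter.Eventually.of_forall fun p =>
        (measurePreserving_sub_right (volume : Measure (Fin d → ℝ)) (η • M⁻¹.mulVec p)).map_eq
  have hmp : MeasurePreserving F volume volume :=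
    (Measure.measurePreserving_swap.comp hskew).comp Measure.measurePreserving_swap
  have hq' : ∀ x, q x = Measure.dirac (F x) := fun x => hq x.1 x.2
  have key : ∀ A B : Set ((Fin d → ℝ) × (Fin d → ℝ)), MeasurableSet A → MeasurableSet B →
      ∫⁻ a in A, q a B = volume (F ⁻¹' B ∩ A) := by
    intro A B hA hB
    have h : ∀ a, q a B = (F ⁻¹' B).indicator 1 a := by
      intro a
      rw [hq', Measure.dirac_apply' _ hB]
      rfl
    simp_rw [h]
    rw [lintegral_indicator_one (hmp.measurable hB),
      Measure.restrict_apply (hmp.measurable hB)]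
  intro A B hA hB
  rw [key A B hA hB, key B A hB hA,
    ← hmp.measure_preimage ((hmp.measurable hB).inter hA).nullMeasurableSet]
  congr 1
  ext x
  simp only [Set.mem_preimage, Set.mem_inter_iff, hinv]
  exact and_comm
end

section
/- Let U : ℝ^d → ℝ be measurable with ∫_{ℝ^d} e^{−U(θ)} dθ < ∞, let M be a positive definite d×d real matrix, and set H(θ, p) = U(θ) + ½ pᵀM⁻¹p. Let Q be any Markov kernel on ℝ^{2d} that is reversible with respect to the Lebesgue measure (in DP-HMC, Q is the noisy leapfrog kernel with momentum flip). Let c > 0 and σ_l(θ, θ') = c‖θ − θ'‖₂, and define the penalty acceptance probability a((θ, p), (θ', p')) = E_{ξ∼N(0, σ_l²(θ,θ'))}[ min{1, exp(H(θ, p) − H(θ', p') + ξ − ½σ_l²(θ, θ'))} ]. Let K be the Metropolis–Hastings kernel K(x, A) = ∫ Q(x, dy)[ a(x, y) 1_A(y) + (1 − a(x, y)) 1_A(x) ], and let π* be the probability measure on ℝ^{2d} with density proportional to exp(−H) with respect to the Lebesgue measure. Then π* is invariant for K, i.e., ∫ K(x, A) π*(dx) = π*(A) for every measurable A ⊆ ℝ^{2d}.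 -/
open MeasureTheory ProbabilityTheory Matrix

lemma aux_gauss_std (s D : ℝ) :
    ∫ ξ, min 1 (Real.exp (D + ξ - s ^ 2 / 2)) ∂(gaussianReal 0 (Real.toNNReal (s ^ 2)))
      = ∫ z, min 1 (Real.exp (D + s * z - s ^ 2 / 2)) ∂(gaussianReal 0 1) := by
  have h : gaussianReal 0 (Real.toNNReal (s ^ 2)) = (gaussianReal 0 1).map (s * ·) := by
    rw [gaussianReal_map_const_mul]
    congr 1
    · simp
    · ext
      simp [sq_nonneg]
  rw [h, integral_map (by fun_prop)]
  apply Measurable.aestronglyMeasurable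
  fun_prop

lemma aux_balance (s h k : ℝ) :
    Real.exp (-h) * ∫ z, min 1 (Real.exp (h - k + s * z - s ^ 2 / 2)) ∂(gaussianReal 0 1)
      = Real.exp (-k) * ∫ z, min 1 (Real.exp (k - h + s * z - s ^ 2 / 2)) ∂(gaussianReal 0 1) := by
  rw [integral_gaussianReal_eq_integral_smul one_ne_zero,
    integral_gaussianReal_eq_integral_smul one_ne_zero,
    ← integral_const_mul, ← integral_const_mul, ← integral_sub_left_eq_self _ volume s]
  congr 1
  ext z
  simp only [gaussianPDFReal, smul_eq_mul]
  have e : ∀ a b e1 c : ℝ, Real.exp a * (c * Real.exp b * min 1 (Real.exp e1))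
      = c * min (Real.exp (a + b)) (Real.exp (a + b + e1)) := by
    intro a b e1 c
    rw [Real.exp_add (a + b) e1, Real.exp_add a b]
    rw [show Real.exp a * (c * Real.exp b * min 1 (Real.exp e1))
      = c * (Real.exp a * Real.exp b * min 1 (Real.exp e1)) by ring,
      mul_min_of_nonneg _ _ (by positivity), mul_one]
  rw [e, e, min_comm]
  congr 3
  · push_cast; ring
  · push_cast; ring

lemma aux_swap {E : Type*} [MeasurableSpace E] (μ : Measure E) [SigmaFinite μ] (Q : Kernel E E)
    [IsMarkovKernel Q] (hQ : Reversible Q μ) :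
    (μ ⊗ₘ Q).map Prod.swap = μ ⊗ₘ Q := by
  symm
  refine Measure.ext_of_generateFrom_of_iUnion _ (fun n => spanningSets μ n ×ˢ Set.univ)
    generateFrom_prod.symm isPiSystem_prod ?_ ?_ ?_ ?_
  · rw [← Set.iUnion_prod_const, iUnion_spanningSets, Set.univ_prod_univ]
  · intro i
    exact ⟨_, measurableSet_spanningSets μ i, _, MeasurableSet.univ, rfl⟩
  · intro i
    rw [Measure.compProd_apply_prod (measurableSet_spanningSets μ i) .univ]
    simpa using (measure_spanningSets_lt_top μ i).ne
  · rintro _ ⟨s, hs, t, ht, rfl⟩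
    rw [Measure.map_apply measurable_swap (MeasurableSet.prod hs ht), Set.preimage_swap_prod,
      Measure.compProd_apply_prod hs ht, Measure.compProd_apply_prod ht hs]
    exact hQ s t hs ht

lemma aux_mh {E : Type*} [MeasurableSpace E] (μ : Measure E) [SigmaFinite μ] (Q : Kernel E E)
    [IsMarkovKernel Q] (hQ : Reversible Q μ) (w : E → ENNReal) (hw : Measurable w)
    (a : E → E → ℝ) (ham : Measurable (Function.uncurry a)) (h0 : ∀ x y, 0 ≤ a x y)
    (h1 : ∀ x y, a x y ≤ 1)
    (hbal : ∀ x y, w x * ENNReal.ofReal (a x y) = w y * ENNReal.ofReal (a y x))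
    (A : Set E) (hA : MeasurableSet A) :
    ∫⁻ x, ∫⁻ y, (ENNReal.ofReal (a x y) * A.indicator (fun _ => (1 : ENNReal)) y
        + ENNReal.ofReal (1 - a x y) * A.indicator (fun _ => (1 : ENNReal)) x) ∂(Q x)
        ∂(μ.withDensity w) = μ.withDensity w A := by
  have hi : Measurable (A.indicator (fun _ => (1 : ENNReal))) := measurable_const.indicator hA
  have ha' : Measurable (fun p : E × E => a p.1 p.2) := ham
  have hF : Measurable (fun p : E × E =>
      ENNReal.ofReal (a p.1 p.2) * A.indicator (fun _ => (1 : ENNReal)) p.2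
        + ENNReal.ofReal (1 - a p.1 p.2) * A.indicator (fun _ => (1 : ENNReal)) p.1) := by
    fun_prop
  have hF1 : Measurable (fun p : E × E =>
      w p.1 * ENNReal.ofReal (a p.1 p.2) * A.indicator (fun _ => (1 : ENNReal)) p.2) := by
    fun_prop
  have hF1' : Measurable (fun p : E × E =>
      w p.1 * ENNReal.ofReal (a p.1 p.2) * A.indicator (fun _ => (1 : ENNReal)) p.1) := by
    fun_prop
  have hF2 : Measurable (fun p : E × E =>
      w p.1 * ENNReal.ofReal (1 - a p.1 p.2) * A.indicator (fun _ => (1 : ENNReal)) p.1) := by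
    fun_prop
  rw [lintegral_withDensity_eq_lintegral_mul _ hw (Measurable.lintegral_kernel_prod_right hF)]
  have step1 : ∀ x, (w * fun x => ∫⁻ y, (ENNReal.ofReal (a x y) *
        A.indicator (fun _ => (1 : ENNReal)) y
        + ENNReal.ofReal (1 - a x y) * A.indicator (fun _ => (1 : ENNReal)) x) ∂(Q x)) x
      = ∫⁻ y, (w x * ENNReal.ofReal (a x y) * A.indicator (fun _ => (1 : ENNReal)) y
        + w x * ENNReal.ofReal (1 - a x y) * A.indicator (fun _ => (1 : ENNReal)) x) ∂(Q x) := by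
    intro x
    rw [Pi.mul_apply]
    refine (lintegral_const_mul _ (hF.comp (measurable_prodMk_left (x := x)))).symm.trans ?_
    congr 1
    ext y
    simp only [Function.comp]
    ring
  simp_rw [step1]
  refine (Measure.lintegral_compProd (μ := μ) (κ := Q) (hF1.add hF2)).symm.trans ?_
  simp only [Pi.add_apply]
  rw [lintegral_add_left hF1]
  nth_rewrite 1 [← aux_swap μ Q hQ]
  rw [lintegral_map hF1 measurable_swap]
  have step2 : ∀ p : E × E, w p.swap.1 * ENNReal.ofReal (a p.swap.1 p.swap.2) *
      A.indicator (fun _ => (1 : ENNReal)) p.swap.2 =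
      w p.1 * ENNReal.ofReal (a p.1 p.2) * A.indicator (fun _ => (1 : ENNReal)) p.1 := by
    intro p
    simp only [Prod.fst_swap, Prod.snd_swap]
    rw [hbal]
  simp_rw [step2]
  rw [← lintegral_add_left hF1']
  have step3 : ∀ p : E × E,
      w p.1 * ENNReal.ofReal (a p.1 p.2) * A.indicator (fun _ => (1 : ENNReal)) p.1
      + w p.1 * ENNReal.ofReal (1 - a p.1 p.2) * A.indicator (fun _ => (1 : ENNReal)) p.1
      = A.indicator w p.1 := by
    intro p
    rw [← add_mul, ← mul_add, ← ENNReal.ofReal_add (h0 _ _) (by linarith [h1 p.1 p.2])]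
    by_cases hp : p.1 ∈ A <;> simp [hp]
  simp_rw [step3]
  refine (Measure.lintegral_compProd (μ := μ) (κ := Q)
    ((hw.indicator hA).comp measurable_fst)).trans ?_
  simp [withDensity_apply _ hA, lintegral_indicator hA]

/-- DP-HMC targets the correct distribution (Theorem `dp_hmc_convergence_theorem`): for any
proposal kernel `Q` on `ℝ^{2d}` reversible with respect to the Lebesgue measure, the
Metropolis–Hastings kernel with the penalty acceptance probability
`a(x, y) = E_{ξ∼N(0, σ_l²)}[min {1, exp (H x − H y + ξ − ½σ_l²)}]`, where
`σ_l(θ, θ') = c‖θ − θ'‖₂`, leaves the target `π* ∝ exp (−H)` invariant. -/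
theorem dp_hmc_invariant_distribution
    (d : ℕ) (U : (Fin d → ℝ) → ℝ) (hU : Measurable U)
    (hUint : ∫⁻ θ, ENNReal.ofReal (Real.exp (-U θ)) < ⊤)
    (M : Matrix (Fin d) (Fin d) ℝ) (hM : M.PosDef)
    (H : (Fin d → ℝ) × (Fin d → ℝ) → ℝ) (hH : H = hamiltonian d U M)
    (Q : Kernel ((Fin d → ℝ) × (Fin d → ℝ)) ((Fin d → ℝ) × (Fin d → ℝ)))
    [IsMarkovKernel Q]
    (hQ : Reversible Q (volume : Measure ((Fin d → ℝ) × (Fin d → ℝ))))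
    (c : ℝ) (hc : 0 < c)
    (σl : (Fin d → ℝ) → (Fin d → ℝ) → ℝ)
    (hσl : ∀ θ θ', σl θ θ' = c * Real.sqrt (∑ i, (θ i - θ' i) ^ 2))
    (a : (Fin d → ℝ) × (Fin d → ℝ) → (Fin d → ℝ) × (Fin d → ℝ) → ℝ)
    (ha : ∀ x y, a x y = ∫ ξ, min 1 (Real.exp (H x - H y + ξ - σl x.1 y.1 ^ 2 / 2))
      ∂(gaussianReal 0 (Real.toNNReal (σl x.1 y.1 ^ 2))))
    (πstar : Measure ((Fin d → ℝ) × (Fin d → ℝ)))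
    (hπ : πstar = (∫⁻ x, ENNReal.ofReal (Real.exp (-H x)))⁻¹
      • volume.withDensity fun x => ENNReal.ofReal (Real.exp (-H x)))
    (K : (Fin d → ℝ) × (Fin d → ℝ) → Set ((Fin d → ℝ) × (Fin d → ℝ)) → ENNReal)
    (hK : ∀ x A, K x A =
      ∫⁻ y, (ENNReal.ofReal (a x y) * A.indicator (fun _ => (1 : ENNReal)) y
        + ENNReal.ofReal (1 - a x y) * A.indicator (fun _ => (1 : ENNReal)) x) ∂(Q x))
    (A : Set ((Fin d → ℝ) × (Fin d → ℝ))) (hA : MeasurableSet A) :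
    ∫⁻ x, K x A ∂πstar = πstar A := by
  have hHm : Measurable H := by
    rw [hH]
    unfold hamiltonian
    have : Continuous fun x : (Fin d → ℝ) × (Fin d → ℝ) => x.2 ⬝ᵥ M⁻¹.mulVec x.2 := by
      fun_prop
    have := this.measurable
    fun_prop
  have ha2 : ∀ x y, a x y =
      ∫ z, min 1 (Real.exp (H x - H y + σl x.1 y.1 * z - σl x.1 y.1 ^ 2 / 2))
        ∂(gaussianReal 0 1) := by
    intro x y
    rw [ha, aux_gauss_std]
  have hsymm : ∀ θ θ', σl θ θ' = σl θ' θ := by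
    intro θ θ'
    rw [hσl, hσl]
    congr 2
    exact Finset.sum_congr rfl fun i _ => by ring
  have hint : ∀ x y, 0 ≤ a x y ∧ a x y ≤ 1 := by
    intro x y
    rw [ha2]
    constructor
    · exact integral_nonneg fun z => le_min zero_le_one (Real.exp_pos _).le
    · have hle := integral_mono_of_nonneg (μ := gaussianReal 0 1)
        (f := fun z => min 1 (Real.exp (H x - H y + σl x.1 y.1 * z - σl x.1 y.1 ^ 2 / 2)))
        (g := fun _ => (1 : ℝ))
        (Filter.Eventually.of_forall fun z => le_min zero_le_one (Real.exp_pos _).le)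
        (integrable_const _) (Filter.Eventually.of_forall fun z => min_le_left _ _)
      simpa using hle
  have ham : Measurable (Function.uncurry a) := by
    have hσm : Measurable fun p : ((Fin d → ℝ) × (Fin d → ℝ)) × ((Fin d → ℝ) × (Fin d → ℝ)) =>
        σl p.1.1 p.2.1 := by
      simp_rw [hσl]
      fun_prop
    have hσm' : Measurable fun q : (((Fin d → ℝ) × (Fin d → ℝ)) × ((Fin d → ℝ) × (Fin d → ℝ))) × ℝ =>
        σl q.1.1.1 q.1.2.1 := hσm.comp measurable_fst
    have he : Function.uncurry a = fun p => ∫ z, (fun q :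
        (((Fin d → ℝ) × (Fin d → ℝ)) × ((Fin d → ℝ) × (Fin d → ℝ))) × ℝ =>
        min 1 (Real.exp (H q.1.1 - H q.1.2 + σl q.1.1.1 q.1.2.1 * q.2
          - σl q.1.1.1 q.1.2.1 ^ 2 / 2))) (p, z) ∂(gaussianReal 0 1) := by
      ext p
      exact ha2 p.1 p.2
    rw [he]
    apply StronglyMeasurable.measurable
    refine StronglyMeasurable.integral_prod_right' (f := fun q :
        (((Fin d → ℝ) × (Fin d → ℝ)) × ((Fin d → ℝ) × (Fin d → ℝ))) × ℝ =>
        min 1 (Real.exp (H q.1.1 - H q.1.2 + σl q.1.1.1 q.1.2.1 * q.2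
          - σl q.1.1.1 q.1.2.1 ^ 2 / 2))) ?_
    apply Measurable.stronglyMeasurable
    have h1 : Measurable fun q :
        (((Fin d → ℝ) × (Fin d → ℝ)) × ((Fin d → ℝ) × (Fin d → ℝ))) × ℝ => H q.1.1 :=
      hHm.comp (measurable_fst.comp measurable_fst)
    have h2 : Measurable fun q :
        (((Fin d → ℝ) × (Fin d → ℝ)) × ((Fin d → ℝ) × (Fin d → ℝ))) × ℝ => H q.1.2 :=
      hHm.comp (measurable_snd.comp measurable_fst)
    exact measurable_const.min (Real.measurable_exp.comp
      (((h1.sub h2).add (hσm'.mul measurable_snd)).sub ((hσm'.pow_const 2).div_const 2)))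
  rw [hπ, lintegral_smul_measure, Measure.smul_apply]
  congr 1
  simp_rw [hK]
  refine aux_mh volume Q hQ _ (by fun_prop) a ham (fun x y => (hint x y).1)
    (fun x y => (hint x y).2) ?_ A hA
  intro x y
  rw [← ENNReal.ofReal_mul (Real.exp_pos _).le, ← ENNReal.ofReal_mul (Real.exp_pos _).le,
    ha2, ha2, hsymm y.1 x.1, aux_balance]
end

section
/- Let σ ≥ 0 and λ ∈ ℝ. Then ∫ min{1, exp(λ + ξ − σ²/2)} dN(0, σ²)(ξ) = e^λ · ∫ min{1, exp(−λ + ξ − σ²/2)} dN(0, σ²)(ξ). That is, the penalty-corrected acceptance probability a(λ) = E_{ξ∼N(0,σ²)}[min{1, e^{λ+ξ−σ²/2}}] satisfies the detailed-balance identity a(λ) = e^λ a(−λ). -/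
open MeasureTheory ProbabilityTheory

/-- The detailed-balance identity of the penalty algorithm: the penalty-corrected acceptance
probability `a(λ) = E_{ξ∼N(0,σ²)}[min {1, exp (λ + ξ − σ²/2)}]` satisfies `a(λ) = e^λ a(−λ)`. -/
theorem penalty_acceptance_detailed_balance (σ lam : ℝ) (hσ : 0 ≤ σ) :
    ∫ ξ, min 1 (Real.exp (lam + ξ - σ ^ 2 / 2)) ∂(gaussianReal 0 (Real.toNNReal (σ ^ 2)))
      = Real.exp lam
        * ∫ ξ, min 1 (Real.exp (-lam + ξ - σ ^ 2 / 2))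
            ∂(gaussianReal 0 (Real.toNNReal (σ ^ 2))) := by
  have key : ∀ a b : ℝ, Real.exp b * min 1 (Real.exp (a - b))
      = Real.exp a * min 1 (Real.exp (-a + b)) := by
    intro a b
    rw [mul_min_of_nonneg _ _ (Real.exp_pos b).le, mul_min_of_nonneg _ _ (Real.exp_pos a).le,
      ← Real.exp_add, ← Real.exp_add, mul_one, mul_one, min_comm]
    congr 2 <;> ring
  rcases hσ.eq_or_lt with h0 | hpos
  · subst h0
    have := key lam 0
    simpa using this
  · have hv : Real.toNNReal (σ ^ 2) ≠ 0 := by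
      have : 0 < σ ^ 2 := by positivity
      simpa using hpos.ne'
    rw [integral_gaussianReal_eq_integral_smul hv, integral_gaussianReal_eq_integral_smul hv,
      ← integral_const_mul, ← integral_sub_left_eq_self _ volume (σ ^ 2)]
    congr 1
    funext x
    have hp : gaussianPDFReal 0 (Real.toNNReal (σ ^ 2)) (σ ^ 2 - x)
        = gaussianPDFReal 0 (Real.toNNReal (σ ^ 2)) x * Real.exp (x - σ ^ 2 / 2) := by
      simp only [gaussianPDFReal, Real.coe_toNNReal _ (sq_nonneg σ)]
      rw [mul_assoc _ (Real.exp _), ← Real.exp_add]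
      congr 2
      field_simp
      ring
    have hk := key lam (x - σ ^ 2 / 2)
    rw [smul_eq_mul, smul_eq_mul, hp, mul_assoc,
      show lam + (σ ^ 2 - x) - σ ^ 2 / 2 = lam - (x - σ ^ 2 / 2) by ring, hk,
      show -lam + x - σ ^ 2 / 2 = -lam + (x - σ ^ 2 / 2) by ring]
    ring
end

section
/- Let g : ℝ^d → ℝ^d be measurable, σ_g > 0, η > 0, L ≥ 1, and let M be a positive definite d×d real matrix. Let Q be the DP-HMC noisy leapfrog proposal kernel with momentum flip on ℝ^{2d}: Q = K_{η/2} ∘ D ∘ K_η ∘ D ∘ ⋯ ∘ K_η ∘ D ∘ K_{η/2} with L copies of D, where K_s((θ, p), ·) is the law of (θ, −p + s·g(θ) + s·σ_g·Z) with Z ∼ N(0, I_d) and D is the Dirac kernel of (θ, p) ↦ (θ − ηM⁻¹p, −p). Then for every starting point (θ₀, p₀) ∈ ℝ^{2d} and every measurable set A ⊆ ℝ^{2d} with positive Lebesgue measure, Q((θ₀, p₀), A) > 0. Consequently, the DP-HMC proposal can reach any set of positive Lebesgue measure from any state in one step, i.e., the DP-HMC chain is strongly irreducible. -/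
open MeasureTheory ProbabilityTheory Matrix

/-- `iterComp κ n = κ ∘ₖ ⋯ ∘ₖ κ` (`n` factors). -/
noncomputable def iterComp {E : Type*} [MeasurableSpace E] (κ : Kernel E E) : ℕ → Kernel E E
  | 0 => Kernel.id
  | n + 1 => κ ∘ₖ iterComp κ n

lemma pi_ac : ∀ (n : ℕ) (μ ν : Fin n → Measure ℝ) [∀ i, SigmaFinite (μ i)]
    [∀ i, SigmaFinite (ν i)], (∀ i, μ i ≪ ν i) → Measure.pi μ ≪ Measure.pi ν := by
  intro n
  induction n with
  | zero =>
    intro μ ν _ _ _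
    rw [Measure.pi_of_empty μ, Measure.pi_of_empty ν]
  | succ n ih =>
    intro μ ν _ _ h
    have h1 := (measurePreserving_piFinSuccAbove μ 0).symm
    have h2 := (measurePreserving_piFinSuccAbove ν 0).symm
    rw [← h1.map_eq, ← h2.map_eq]
    exact ((h 0).prod (ih _ _ fun i => h _)).map h1.measurable

lemma gauss_pos (d : ℕ) (m : Fin d → ℝ) (v : NNReal) (hv : v ≠ 0) (B : Set (Fin d → ℝ))
    (hB : 0 < volume B) : 0 < gaussPi d m v B := by
  have h : (volume : Measure (Fin d → ℝ)) ≪ gaussPi d m v :=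
    pi_ac d (fun _ => volume) _ fun i => gaussianReal_absolutelyContinuous' (m i) hv
  rw [pos_iff_ne_zero] at hB ⊢
  exact fun h0 => hB (h h0)

lemma dirac_prod_pos (d : ℕ) (θ m : Fin d → ℝ) (v : NNReal) (hv : v ≠ 0)
    (A : Set ((Fin d → ℝ) × (Fin d → ℝ))) (hA : MeasurableSet A)
    (hB : 0 < volume (Prod.mk θ ⁻¹' A)) :
    0 < ((Measure.dirac θ).prod (gaussPi d m v)) A := by
  have : IsProbabilityMeasure (gaussPi d m v) := by unfold gaussPi; infer_instance
  rw [Measure.prod_apply hA, lintegral_dirac' _ (measurable_measure_prodMk_left hA)]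
  exact gauss_pos d m v hv _ hB

lemma comp_pos_of {E : Type*} [MeasurableSpace E] (κ τ : Kernel E E) (x : E) (A : Set E)
    (hA : MeasurableSet A) (B : Set E) (hB : 0 < τ x B) (h : ∀ y ∈ B, 0 < κ y A) :
    0 < (κ ∘ₖ τ) x A := by
  rw [Kernel.comp_apply' _ _ _ hA, lintegral_pos_iff_support (κ.measurable_coe hA)]
  exact hB.trans_le (measure_mono fun y hy => (h y hy).ne')

lemma vol_affine (d : ℕ) (M : Matrix (Fin d) (Fin d) ℝ) (hM : M.PosDef) (η : ℝ) (hη : 0 < η)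
    (θ : Fin d → ℝ) (B : Set (Fin d → ℝ)) (hB : 0 < volume B) :
    0 < volume {p : Fin d → ℝ | θ - η • M⁻¹.mulVec p ∈ B} := by
  let f : (Fin d → ℝ) →ₗ[ℝ] (Fin d → ℝ) := Matrix.toLin' ((-η) • M⁻¹)
  have hdet : LinearMap.det f ≠ 0 := by
    simp only [f, LinearMap.det_toLin', Matrix.det_smul, Matrix.det_nonsing_inv]
    refine mul_ne_zero (pow_ne_zero _ (neg_ne_zero.2 hη.ne')) ?_
    rw [Ring.inverse_eq_inv']
    exact inv_ne_zero hM.det_pos.ne'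
  have he : {p : Fin d → ℝ | θ - η • M⁻¹.mulVec p ∈ B} = f ⁻¹' ((fun q => θ + q) ⁻¹' B) := by
    ext p
    simp [f, Matrix.smul_mulVec, sub_eq_add_neg, Matrix.neg_mulVec]
  rw [he, Measure.addHaar_preimage_linearMap _ hdet, measure_preimage_add]
  refine ENNReal.mul_pos ?_ hB.ne'
  simpa using hdet

/-- The DP-HMC noisy leapfrog proposal kernel with momentum flip,
`Q = K_{η/2} ∘ D ∘ K_η ∘ D ∘ ⋯ ∘ K_η ∘ D ∘ K_{η/2}` (applied right-to-left, with `L` copies of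
`D` and `L − 1` copies of `K_η`), where `K_s((θ, p), ·)` is the law of
`(θ, −p + s·g(θ) + s·σ_g·Z)` with `Z ∼ N(0, I_d)` and `D` is the Dirac kernel of
`(θ, p) ↦ (θ − ηM⁻¹p, −p)`, assigns positive probability to every set of positive Lebesgue
measure from every starting point: DP-HMC is strongly irreducible
(Theorem `dp_hmc_ergodic_theorem`). -/
theorem dp_hmc_strongly_irreducible
    (d : ℕ) (g : (Fin d → ℝ) → (Fin d → ℝ)) (hg : Measurable g)
    (σg η : ℝ) (hσg : 0 < σg) (hη : 0 < η) (L : ℕ) (hL : 1 ≤ L)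
    (M : Matrix (Fin d) (Fin d) ℝ) (hM : M.PosDef)
    (K : ℝ → Kernel ((Fin d → ℝ) × (Fin d → ℝ)) ((Fin d → ℝ) × (Fin d → ℝ)))
    [∀ s, IsMarkovKernel (K s)]
    (hK : ∀ s θ p, K s (θ, p)
      = (Measure.dirac θ).prod (gaussPi d (-p + s • g θ) (Real.toNNReal ((s * σg) ^ 2))))
    (D : Kernel ((Fin d → ℝ) × (Fin d → ℝ)) ((Fin d → ℝ) × (Fin d → ℝ)))
    [IsMarkovKernel D]
    (hD : ∀ θ p : Fin d → ℝ, D (θ, p) = Measure.dirac (θ - η • M⁻¹.mulVec p, -p))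
    (Q : Kernel ((Fin d → ℝ) × (Fin d → ℝ)) ((Fin d → ℝ) × (Fin d → ℝ)))
    (hQ : Q = K (η / 2) ∘ₖ (iterComp (D ∘ₖ K η) (L - 1) ∘ₖ (D ∘ₖ K (η / 2))))
    (x : (Fin d → ℝ) × (Fin d → ℝ))
    (A : Set ((Fin d → ℝ) × (Fin d → ℝ))) (hA : MeasurableSet A)
    (hApos : 0 < volume A) :
    0 < Q x A := by
  have hv : ∀ s : ℝ, 0 < s → Real.toNNReal ((s * σg) ^ 2) ≠ 0 := fun s hs =>
    (Real.toNNReal_pos.2 (by positivity)).ne'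
  have hstep : ∀ s : ℝ, 0 < s → ∀ (y : (Fin d → ℝ) × (Fin d → ℝ)) (B : Set (Fin d → ℝ)),
      MeasurableSet B → 0 < volume B → 0 < (D ∘ₖ K s) y (Prod.fst ⁻¹' B) := by
    rintro s hs ⟨θ, p⟩ B hB hBpos
    have hmeas : Measurable fun z : (Fin d → ℝ) × (Fin d → ℝ) => z.1 - η • M⁻¹.mulVec z.2 := by
      apply Continuous.measurable
      exact continuous_fst.sub ((Continuous.matrix_mulVec continuous_const continuous_snd).const_smul η)
    refine comp_pos_of D (K s) _ _ (measurable_fst hB)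
      ((fun z : (Fin d → ℝ) × (Fin d → ℝ) => z.1 - η • M⁻¹.mulVec z.2) ⁻¹' B) ?_ ?_
    · rw [hK]
      exact dirac_prod_pos d θ _ _ (hv s hs) _ (hmeas hB) (vol_affine d M hM η hη θ B hBpos)
    · rintro ⟨a, b⟩ hab
      rw [hD, Measure.dirac_apply' _ (measurable_fst hB)]
      have : (a - η • M⁻¹.mulVec b, -b) ∈ (Prod.fst ⁻¹' B : Set ((Fin d → ℝ) × (Fin d → ℝ))) := hab
      simp [Set.indicator_of_mem this]
  have hiter : ∀ n : ℕ, IsMarkovKernel (iterComp (D ∘ₖ K η) n) := by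
    intro n
    induction n with
    | zero => unfold iterComp; infer_instance
    | succ n ih => unfold iterComp; infer_instance
  have hR : ∀ n : ℕ, ∀ B : Set (Fin d → ℝ), MeasurableSet B → 0 < volume B →
      0 < (iterComp (D ∘ₖ K η) n ∘ₖ (D ∘ₖ K (η / 2))) x (Prod.fst ⁻¹' B) := by
    intro n B hB hBpos
    cases n with
    | zero =>
      unfold iterComp
      rw [Kernel.id_comp]
      exact hstep _ (by positivity) x B hB hBpos
    | succ n =>
      unfold iterComp
      rw [Kernel.comp_assoc]
      have := hiter n
      exact comp_pos_of _ _ _ _ (measurable_fst hB) Set.univ (by simp)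
        fun y _ => hstep η hη y B hB hBpos
  subst hQ
  have hm : Measurable fun θ : Fin d → ℝ => (volume : Measure (Fin d → ℝ)) (Prod.mk θ ⁻¹' A) :=
    measurable_measure_prodMk_left hA
  refine comp_pos_of _ _ _ _ hA
    (Prod.fst ⁻¹' (Function.support fun θ : Fin d → ℝ =>
      (volume : Measure (Fin d → ℝ)) (Prod.mk θ ⁻¹' A))) (hR _ _ ?_ ?_) ?_
  · exact measurableSet_support hm
  · rw [← lintegral_pos_iff_support hm, ← Measure.prod_apply hA]
    exact hApos
  · rintro ⟨θ, p⟩ h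
    rw [hK]
    exact dirac_prod_pos d θ _ _ (hv _ (by positivity)) A hA (pos_iff_ne_zero.2 h)
end
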